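/- For a uniformly random permutation π of {1,...,n} and integers 2 ≤ s < r ≤ n, the probability that the lexicographically first increasing triple of π is {1,s,r} equals ∑_{k=0}^{s-2} C(s-2,k)·C(r-k-2, s-k-1)·(s-k-2)!·(r-s-1)! / (n·(n-1)···(n-k+1)·(r-k)!). -/

import Mathlib

open Finset

attribute [local instance] Classical.propDecidable

/-- The lexicographically first increasing (I-II-III) pattern of `π` occurs at
positions `a < b < c` (0-indexed elements of `Fin n`). -/
def FirstIncTripleAt (n : ℕ) (π : Equiv.Perm (Fin n)) (a b c : Fin n) : Prop :=
  a < b ∧ b < c ∧ π a < π b ∧ π b < π c ∧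
  ∀ d e f : Fin n, d < e → e < f →
    (d < a ∨ (d = a ∧ (e < b ∨ (e = b ∧ f < c)))) →
    ¬ (π d < π e ∧ π e < π f)

noncomputable def cnt {n : ℕ} (P : Equiv.Perm (Fin n) → Prop) : ℕ :=
  (univ.filter (fun π => P π)).card

lemma argmax_step {n : ℕ} (Q : Equiv.Perm (Fin n) → Prop) (A : Finset (Fin n)) (a : Fin n)
    (ha : a ∈ A) (hQ : ∀ b ∈ A, ∀ b' ∈ A, ∀ π, Q π → Q (π * Equiv.swap b b')) :
    cnt (fun π : Equiv.Perm (Fin n) => Q π ∧ ∀ x ∈ A, π x ≤ π a) * A.card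
      = cnt (fun π : Equiv.Perm (Fin n) => Q π) := by
  unfold cnt
  have key : ∀ b ∈ A, ∀ c ∈ A,
      cnt (fun π : Equiv.Perm (Fin n) => Q π ∧ ∀ x ∈ A, π x ≤ π b)
      ≤ cnt (fun π : Equiv.Perm (Fin n) => Q π ∧ ∀ x ∈ A, π x ≤ π c) := by
    intro b hb c hc
    unfold cnt
    refine Finset.card_le_card_of_injOn (fun π => π * Equiv.swap b c) ?_ ?_
    · intro π hπ
      simp only [coe_filter, mem_univ, true_and, Set.mem_ofPred_eq] at hπ ⊢
      refine ⟨hQ b hb c hc π hπ.1, ?_⟩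
      intro x hx
      simp only [Equiv.Perm.mul_apply, Equiv.swap_apply_right]
      apply hπ.2
      rw [Equiv.swap_apply_def]
      split_ifs <;> assumption
    · intro π _ ρ _ h
      exact mul_right_cancel h
  unfold cnt at key
  have huniq : (univ.filter (fun π : Equiv.Perm (Fin n) => Q π)) =
      A.biUnion (fun b => univ.filter
        (fun π : Equiv.Perm (Fin n) => Q π ∧ ∀ x ∈ A, π x ≤ π b)) := by
    ext π
    simp only [mem_filter, mem_univ, true_and, mem_biUnion]
    constructor
    · intro h
      obtain ⟨b, hb, hb'⟩ := Finset.exists_max_image A π ⟨a, ha⟩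
      exact ⟨b, hb, h, hb'⟩
    · rintro ⟨b, _, h, _⟩
      exact h
  rw [huniq, Finset.card_biUnion]
  · have hb' := Finset.sum_congr rfl (fun b hb => le_antisymm (key b hb a ha) (key a ha b hb))
    rw [Finset.sum_const, smul_eq_mul, mul_comm] at hb'
    rw [← hb']
    refine Finset.sum_congr rfl (fun b _ => ?_)
    congr
  · intro b hb c hc hbc
    rw [Function.onFun, Finset.disjoint_left]
    intro π h1 h2
    simp only [mem_filter, mem_univ, true_and] at h1 h2
    exact hbc (π.injective (le_antisymm (h2.2 b hb) (h1.2 c hc)))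

def QT {n : ℕ} (T : Finset (Fin n)) (π : Equiv.Perm (Fin n)) : Prop :=
  ∀ t ∈ T, ∀ y, (y ∈ T → t ≤ y) → π y ≤ π t

lemma swap_mem_iff {n : ℕ} {A : Finset (Fin n)} {b c : Fin n} (h : b ∈ A ↔ c ∈ A) (x : Fin n) :
    Equiv.swap b c x ∈ A ↔ x ∈ A := by
  rw [Equiv.swap_apply_def]
  split_ifs with h1 h2
  · subst h1; exact h.symm
  · subst h2; exact h
  · rfl

lemma QT_swap {n : ℕ} {T : Finset (Fin n)} {b c : Fin n} (hb : b ∉ T) (hc : c ∉ T)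
    (π : Equiv.Perm (Fin n)) (h : QT T π) : QT T (π * Equiv.swap b c) := by
  intro t ht y hy
  simp only [Equiv.Perm.mul_apply]
  have h1 : Equiv.swap b c t = t :=
    Equiv.swap_apply_of_ne_of_ne (fun e => hb (e ▸ ht)) (fun e => hc (e ▸ ht))
  rw [h1]
  apply h t ht
  intro hm
  have hyT := (swap_mem_iff (by simp [hb, hc]) y).1 hm
  have h2 : Equiv.swap b c y = y :=
    Equiv.swap_apply_of_ne_of_ne (fun e => hb (e ▸ hyT)) (fun e => hc (e ▸ hyT))
  rw [h2]
  exact hy hyT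

lemma max_swap {n : ℕ} {A : Finset (Fin n)} {a b c : Fin n} (hA : b ∈ A ↔ c ∈ A)
    (hb : b ≠ a) (hc : c ≠ a)
    (π : Equiv.Perm (Fin n)) (h : ∀ x ∈ A, π x ≤ π a) :
    ∀ x ∈ A, (π * Equiv.swap b c) x ≤ (π * Equiv.swap b c) a := by
  intro x hx
  simp only [Equiv.Perm.mul_apply]
  rw [Equiv.swap_apply_of_ne_of_ne hb.symm hc.symm]
  exact h _ ((swap_mem_iff hA x).2 hx)

lemma card_QT {n : ℕ} (T : Finset (Fin n)) :
    cnt (fun π : Equiv.Perm (Fin n) => QT T π) * n.descFactorial T.card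
      = n.factorial := by
  induction T using Finset.induction_on_max with
  | empty => simp [cnt, QT, Fintype.card_perm]
  | insert a T hT ih =>
    have haT : a ∉ T := fun h => lt_irrefl _ (hT a h)
    have hst := argmax_step (QT T) (univ \ T) a (by simp [haT])
      (fun b hb c hc π h => QT_swap (by simpa using hb) (by simpa using hc) π h)
    have heq : ∀ π : Equiv.Perm (Fin n),
        QT (insert a T) π ↔ (QT T π ∧ ∀ x ∈ univ \ T, π x ≤ π a) := by
      intro π
      constructor
      · intro h
        refine ⟨fun t ht y hy => h t (mem_insert_of_mem ht) y ?_, fun x hx => h a (mem_insert_self _ _) x ?_⟩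
        · intro hm
          rcases mem_insert.1 hm with rfl | hm
          · exact (hT t ht).le
          · exact hy hm
        · intro hm
          rcases mem_insert.1 hm with rfl | hm
          · exact le_rfl
          · simp [hm] at hx
      · rintro ⟨h1, h2⟩ t ht y hy
        rcases mem_insert.1 ht with rfl | ht
        · apply h2
          simp only [mem_sdiff, mem_univ, true_and]
          intro hm
          exact absurd (hy (mem_insert_of_mem hm)) (not_le.2 (hT y hm))
        · exact h1 t ht y (fun hm => hy (mem_insert_of_mem hm))
    simp_rw [heq]
    rw [card_insert_of_notMem haT, Nat.descFactorial_succ, ← ih, ← hst]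
    rw [card_sdiff_of_subset (subset_univ _), card_univ, Fintype.card_fin]
    ring

def ET {n : ℕ} (T : Finset (Fin n)) (o s r : Fin n) (π : Equiv.Perm (Fin n)) : Prop :=
  ((QT T π ∧ ∀ x ∈ Iic r \ T, π x ≤ π r) ∧ ∀ x ∈ Iio r \ T, π x ≤ π s) ∧
    ∀ x ∈ Iio s \ T, π x ≤ π o

lemma card_ET {n : ℕ} (T : Finset (Fin n)) (o s r : Fin n) (hos : o < s) (hsr : s < r)
    (hT : ∀ t ∈ T, o < t ∧ t < s) :
    cnt (fun π : Equiv.Perm (Fin n) => ET T o s r π)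
      * ((s - T.card) * (r - T.card) * (r + 1 - T.card)) * n.descFactorial T.card
      = n.factorial := by
  have hoT : o ∉ T := fun h => lt_irrefl _ (hT o h).1
  have hsT : s ∉ T := fun h => lt_irrefl _ (hT s h).2
  have hrT : r ∉ T := fun h => lt_asymm hsr (hT r h).2
  have h1 := argmax_step (QT T) (Iic r \ T) r (by simp [hrT])
      (fun b hb c hc π h => QT_swap (by simp at hb; exact hb.2) (by simp at hc; exact hc.2) π h)
  have h2 := argmax_step (fun π => QT T π ∧ ∀ x ∈ Iic r \ T, π x ≤ π r) (Iio r \ T) s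
      (by simp [hsT, hsr]) (fun b hb c hc π h => by
        simp only [mem_sdiff, mem_Iio] at hb hc
        exact ⟨QT_swap hb.2 hc.2 π h.1, max_swap (by simp [hb.1.le, hc.1.le, hb.2, hc.2])
          hb.1.ne hc.1.ne π h.2⟩)
  have h3 := argmax_step (fun π => (QT T π ∧ ∀ x ∈ Iic r \ T, π x ≤ π r) ∧
        ∀ x ∈ Iio r \ T, π x ≤ π s) (Iio s \ T) o
      (by simp [hoT, hos]) (fun b hb c hc π h => by
        simp only [mem_sdiff, mem_Iio] at hb hc
        have hb' := hb.1.trans hsr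
        have hc' := hc.1.trans hsr
        exact ⟨⟨QT_swap hb.2 hc.2 π h.1.1, max_swap (by simp [hb'.le, hc'.le, hb.2, hc.2])
          hb'.ne hc'.ne π h.1.2⟩, max_swap (by simp [hb', hc', hb.2, hc.2])
          hb.1.ne hc.1.ne π h.2⟩)
  rw [card_sdiff_of_subset (fun t ht => mem_Iic.2 ((hT t ht).2.trans hsr).le), Fin.card_Iic] at h1
  rw [card_sdiff_of_subset (fun t ht => mem_Iio.2 ((hT t ht).2.trans hsr)), Fin.card_Iio] at h2
  rw [card_sdiff_of_subset (fun t ht => mem_Iio.2 (hT t ht).2), Fin.card_Iio] at h3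
  have h4 := card_QT T
  rw [← h1, ← h2, ← h3] at h4
  rw [← h4]
  unfold ET
  ring

lemma first_iff {n : ℕ} (T : Finset (Fin n)) (o s r : Fin n) (hos : o < s) (hsr : s < r)
    (ho : ∀ x, o ≤ x) (hT : T ⊆ Ioo o s) (π : Equiv.Perm (Fin n)) :
    (FirstIncTripleAt n π o s r ∧ (Ioo o s).filter (fun e => π o < π e) = T) ↔ ET T o s r π := by
  have hT' : ∀ t ∈ T, o < t ∧ t < s := fun t ht => mem_Ioo.1 (hT ht)
  constructor
  · rintro ⟨⟨-, -, h1, h2, h3⟩, hH⟩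
    have hlow : ∀ x, x < s → x ∉ T → π x ≤ π o := by
      intro x hx hxT
      rcases (ho x).eq_or_lt with h | h
      · rw [h]
      · by_contra hc
        exact hxT (hH ▸ mem_filter.2 ⟨mem_Ioo.2 ⟨h, hx⟩, not_le.1 hc⟩)
    have hhigh : ∀ t ∈ T, π o < π t := by
      intro t ht
      rw [← hH] at ht
      exact (mem_filter.1 ht).2
    have hmid : ∀ x, x < r → x ∉ T → π x ≤ π s := by
      intro x hx hxT
      rcases lt_trichotomy x s with h | h | h
      · exact (hlow x h hxT).trans h1.le
      · rw [h]
      · by_contra hc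
        exact h3 o s x hos h (Or.inr ⟨rfl, Or.inr ⟨rfl, hx⟩⟩) ⟨h1, not_le.1 hc⟩
    refine ⟨⟨⟨?_, ?_⟩, ?_⟩, ?_⟩
    · intro t ht y hy
      rcases lt_trichotomy y t with h | h | h
      · exact (hlow y (h.trans (hT' t ht).2) (fun hm => absurd (hy hm) (not_le.2 h))).trans
          (hhigh t ht).le
      · rw [h]
      · by_contra hc
        exact h3 o t y (hT' t ht).1 h (Or.inr ⟨rfl, Or.inl (hT' t ht).2⟩)
          ⟨hhigh t ht, not_le.1 hc⟩
    · intro x hx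
      simp only [mem_sdiff, mem_Iic] at hx
      rcases hx.1.eq_or_lt with h | h
      · rw [h]
      · exact (hmid x h hx.2).trans h2.le
    · intro x hx
      simp only [mem_sdiff, mem_Iio] at hx
      exact hmid x hx.1 hx.2
    · intro x hx
      simp only [mem_sdiff, mem_Iio] at hx
      exact hlow x hx.1 hx.2
  · rintro ⟨⟨⟨hQ, hr⟩, hs⟩, h0⟩
    simp only [mem_sdiff, mem_Iio, mem_Iic, and_imp] at hr hs h0
    have hoT : o ∉ T := fun h => lt_irrefl _ (hT' o h).1
    have hsT : s ∉ T := fun h => lt_irrefl _ (hT' s h).2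
    have hlt : ∀ {x y}, x ≠ y → π x ≤ π y → π x < π y := fun hne hle =>
      lt_of_le_of_ne hle (fun h => hne (π.injective h))
    refine ⟨⟨hos, hsr, hlt hos.ne (hs o (hos.trans hsr) hoT), hlt hsr.ne (hr s hsr.le hsT), ?_⟩, ?_⟩
    · rintro d e f hde hef (h | ⟨rfl, h | ⟨rfl, h⟩⟩) ⟨h1, h2⟩
      · exact absurd (ho d) (not_le.2 h)
      · by_cases heT : e ∈ T
        · exact absurd (hQ e heT f (fun _ => hef.le)) (not_le.2 h2)
        · exact absurd (h0 e h heT) (not_le.2 h1)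
      · exact absurd (hs f h (fun hm => lt_asymm hef (hT' f hm).2)) (not_le.2 h2)
    · ext e
      simp only [mem_filter, mem_Ioo]
      constructor
      · rintro ⟨⟨h1, h2⟩, h3⟩
        by_contra heT
        exact absurd (h0 e h2 heT) (not_le.2 h3)
      · intro he
        exact ⟨hT' e he, hlt (hT' e he).1.ne (hQ e he o (fun h => absurd h hoT))⟩

lemma coeff_eq (n s r k : ℕ) (hsr : s < r) (hk : k < s - 1) (c : ℕ) (hrn : r ≤ n)
    (hc : c * ((s - 1 - k) * (r - 1 - k) * (r - 1 + 1 - k)) * n.descFactorial k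
      = n.factorial) :
    (c : ℚ) / n.factorial = ((Nat.choose (r - k - 2) (s - k - 1) : ℚ)
              * (Nat.factorial (s - k - 2) : ℚ) * (Nat.factorial (r - s - 1) : ℚ))
            / ((Nat.descFactorial n k : ℚ) * (Nat.factorial (r - k) : ℚ)) := by
  obtain ⟨a, rfl⟩ : ∃ a, s = k + 2 + a := ⟨s - k - 2, by omega⟩
  obtain ⟨b, rfl⟩ : ∃ b, r = k + 2 + a + b + 1 := ⟨r - (k + 2 + a) - 1, by omega⟩
  have e1 : k + 2 + a + b + 1 - k - 2 = (a + 1) + b := by omega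
  have e2 : k + 2 + a - k - 1 = a + 1 := by omega
  have e3 : k + 2 + a - k - 2 = a := by omega
  have e4 : k + 2 + a + b + 1 - (k + 2 + a) - 1 = b := by omega
  have e5 : k + 2 + a + b + 1 - k = (a + 1 + b) + 1 + 1 := by omega
  have e6 : k + 2 + a - 1 - k = a + 1 := by omega
  have e7 : k + 2 + a + b + 1 - 1 - k = a + 1 + b + 1 := by omega
  have e8 : k + 2 + a + b + 1 - 1 + 1 - k = a + 1 + b + 1 + 1 := by omega
  rw [e6, e7, e8] at hc
  rw [e1, e2, e3, e4, e5]
  have hd : (n.descFactorial k : ℚ) ≠ 0 := by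
    have : n.descFactorial k ≠ 0 := by
      rw [Ne, Nat.descFactorial_eq_zero_iff_lt]; omega
    exact_mod_cast this
  have hch := Nat.choose_mul_factorial_mul_factorial (Nat.le_add_right (a + 1) b)
  rw [Nat.add_sub_cancel_left] at hch
  have hn : (n.factorial : ℚ) ≠ 0 := by exact_mod_cast Nat.factorial_ne_zero n
  rw [div_eq_div_iff hn (mul_ne_zero hd (by exact_mod_cast Nat.factorial_ne_zero _))]
  norm_cast
  rw [← hc, Nat.factorial_succ (a + 1 + b + 1), Nat.factorial_succ (a + 1 + b), ← hch,
    Nat.factorial_succ a]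
  ring

/-- `P(X = {1,s,r}) = ∑_{k=0}^{s-2} C(s-2,k)·C(r-k-2,s-k-1)·(s-k-2)!·(r-s-1)!
  / (n(n-1)⋯(n-k+1)·(r-k)!)`, where `n(n-1)⋯(n-k+1)` is the descending factorial. -/
theorem stmt_12 (n s r : ℕ) (hs : 2 ≤ s) (hsr : s < r) (hrn : r ≤ n) :
    ((Finset.univ.filter (fun π : Equiv.Perm (Fin n) =>
        FirstIncTripleAt n π ⟨0, by omega⟩ ⟨s - 1, by omega⟩ ⟨r - 1, by omega⟩)).card : ℚ)
        / (Nat.factorial n : ℚ)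
      = ∑ k ∈ Finset.range (s - 1),
          ((Nat.choose (s - 2) k : ℚ) * (Nat.choose (r - k - 2) (s - k - 1) : ℚ)
              * (Nat.factorial (s - k - 2) : ℚ) * (Nat.factorial (r - s - 1) : ℚ))
            / ((Nat.descFactorial n k : ℚ) * (Nat.factorial (r - k) : ℚ)) := by
  set o : Fin n := ⟨0, by omega⟩ with ho
  set S : Fin n := ⟨s - 1, by omega⟩ with hS
  set R : Fin n := ⟨r - 1, by omega⟩ with hR
  have hoS : o < S := Fin.mk_lt_mk.2 (by omega)
  have hSR : S < R := Fin.mk_lt_mk.2 (by omega)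
  have ho' : ∀ x, o ≤ x := fun x => Fin.mk_le_mk.2 (Nat.zero_le _)
  have hcardI : (Ioo o S).card = s - 2 := by
    rw [Fin.card_Ioo]; simp [ho, hS]; omega
  rw [Finset.card_eq_sum_card_fiberwise (t := (Ioo o S).powerset)
    (f := fun π : Equiv.Perm (Fin n) => (Ioo o S).filter (fun e => π o < π e))
    (fun π _ => Finset.mem_coe.2 (mem_powerset.2 (filter_subset _ _)))]
  rw [Nat.cast_sum, Finset.sum_div]
  let g : ℕ → ℚ := fun k => ((Nat.choose (r - k - 2) (s - k - 1) : ℚ)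
              * (Nat.factorial (s - k - 2) : ℚ) * (Nat.factorial (r - s - 1) : ℚ))
            / ((Nat.descFactorial n k : ℚ) * (Nat.factorial (r - k) : ℚ))
  have hterm : ∀ T ∈ (Ioo o S).powerset,
      (((univ.filter (fun π : Equiv.Perm (Fin n) => FirstIncTripleAt n π o S R)).filter
        (fun π : Equiv.Perm (Fin n) => (Ioo o S).filter (fun e => π o < π e) = T)).card : ℚ)
        / n.factorial = g T.card := by
    intro T hT
    rw [mem_powerset] at hT
    have hle := card_le_card hT
    rw [hcardI] at hle
    apply coeff_eq n s r T.card hsr (by omega) _ hrn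
    rw [filter_filter]
    simp_rw [first_iff T o S R hoS hSR ho' hT]
    exact card_ET T o S R hoS hSR (fun t ht => mem_Ioo.1 (hT ht))
  rw [Finset.sum_congr rfl hterm, Finset.sum_powerset_apply_card g, hcardI]
  have e : s - 2 + 1 = s - 1 := by omega
  rw [e]
  refine Finset.sum_congr rfl (fun k _ => ?_)
  rw [nsmul_eq_mul]
  simp only [g]
  ring
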